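/- Let k, n be positive integers with n < k, and let p₀,…,p_k ∈ ℝ^{1,n} be (k+1) points such that dim V(p₀,…,pₙ) = dim V(p₀,…,p_k) = n. Then the Lorentzian distance-squared mapping L_{(p₀,…,p_k)} : ℝ^{1,n} → ℝ^{k+1} is A-equivalent to τ ∘ Φₙ if and only if the recognition subspace V(p₀,…,p_k) is time-like or space-like, where τ : ℝ^{n+1} → ℝ^{k+1} is the inclusion τ(X₀,…,Xₙ) = (X₀,…,Xₙ, 0,…,0) and Φₙ(x₀,…,xₙ) = (x₁,…,xₙ, x₀²). -/

import Mathlib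

open scoped BigOperators

noncomputable section

/-- The Lorentzian inner product on `ℝ^{1,n}`, modeled as `Fin (n+1) → ℝ`:
`⟨x,y⟩ = -x₀y₀ + x₁y₁ + ⋯ + xₙyₙ`. -/
def lorIP {n : ℕ} (x y : Fin (n + 1) → ℝ) : ℝ :=
  (∑ i, x i * y i) - 2 * (x 0 * y 0)

/-- The Euclidean inner product on `Fin m → ℝ`. -/
def eucIP {m : ℕ} (x y : Fin m → ℝ) : ℝ := ∑ i, x i * y i

/-- The Lorentzian distance-squared mapping determined by the points `p 0, …, p (m-1)`. -/
def LorDSM {n m : ℕ} (p : Fin m → Fin (n + 1) → ℝ) :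
    (Fin (n + 1) → ℝ) → (Fin m → ℝ) :=
  fun x i => lorIP (x - p i) (x - p i)

/-- The Euclidean distance-squared mapping determined by the points `p 0, …, p (m-1)`. -/
def EucDSM {n m : ℕ} (p : Fin m → Fin (n + 1) → ℝ) :
    (Fin (n + 1) → ℝ) → (Fin m → ℝ) :=
  fun x i => eucIP (x - p i) (x - p i)

/-- The recognition subspace `V(p₀, …, p_k)`: the span of the vectors `p i - p 0`. -/
def recSub {n k : ℕ} (p : Fin (k + 1) → Fin (n + 1) → ℝ) :
    Submodule ℝ (Fin (n + 1) → ℝ) :=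
  Submodule.span ℝ (Set.range fun i => p i - p 0)

/-- The partial recognition subspace `V(p₀, …, p_j)`: the span of `p i - p 0` for `i ≤ j`. -/
def recSubUpTo {n k : ℕ} (p : Fin (k + 1) → Fin (n + 1) → ℝ) (j : ℕ) :
    Submodule ℝ (Fin (n + 1) → ℝ) :=
  Submodule.span ℝ {v | ∃ i : Fin (k + 1), (i : ℕ) ≤ j ∧ v = p i - p 0}

/-- A subspace is time-like iff it contains a vector of negative Lorentzian square. -/
def LTimeLike {n : ℕ} (V : Submodule ℝ (Fin (n + 1) → ℝ)) : Prop :=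
  ∃ v ∈ V, lorIP v v < 0

/-- A subspace is space-like iff every nonzero vector in it has positive Lorentzian square. -/
def LSpaceLike {n : ℕ} (V : Submodule ℝ (Fin (n + 1) → ℝ)) : Prop :=
  ∀ v ∈ V, v ≠ 0 → 0 < lorIP v v

/-- A subspace is light-like iff it is neither time-like nor space-like. -/
def LLightLike {n : ℕ} (V : Submodule ℝ (Fin (n + 1) → ℝ)) : Prop :=
  ¬ LTimeLike V ∧ ¬ LSpaceLike V

/-- `f` and `g` are `𝒜`-equivalent: `g = H ∘ f ∘ h` for `C^∞` diffeomorphisms `h, H`. -/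
def AEquiv {a b : ℕ} (f g : (Fin a → ℝ) → (Fin b → ℝ)) : Prop :=
  ∃ (h : (Fin a → ℝ) ≃ (Fin a → ℝ)) (H : (Fin b → ℝ) ≃ (Fin b → ℝ)),
    ContDiff ℝ (⊤ : ℕ∞) ⇑h ∧ ContDiff ℝ (⊤ : ℕ∞) ⇑h.symm ∧
    ContDiff ℝ (⊤ : ℕ∞) ⇑H ∧ ContDiff ℝ (⊤ : ℕ∞) ⇑H.symm ∧
    g = ⇑H ∘ f ∘ ⇑h

/-- The Lorentzian inner product as a bilinear map. -/
def lorForm (n : ℕ) :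
    (Fin (n + 1) → ℝ) →ₗ[ℝ] (Fin (n + 1) → ℝ) →ₗ[ℝ] ℝ :=
  LinearMap.mk₂ ℝ lorIP
    (fun x y z => by simp [lorIP, add_mul, Finset.sum_add_distrib]; ring)
    (fun c x y => by simp [lorIP, mul_assoc, ← Finset.mul_sum]; ring)
    (fun x y z => by simp [lorIP, mul_add, Finset.sum_add_distrib]; ring)
    (fun c x y => by simp [lorIP, mul_left_comm, ← Finset.mul_sum]; ring)

theorem lorForm_apply {n : ℕ} (x y : Fin (n + 1) → ℝ) : lorForm n x y = lorIP x y := rfl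

theorem lorIP_comm {n : ℕ} (x y : Fin (n + 1) → ℝ) : lorIP x y = lorIP y x := by
  simp [lorIP, mul_comm]

theorem lorIP_add_self {n : ℕ} (x y : Fin (n + 1) → ℝ) :
    lorIP (x + y) (x + y) = lorIP x x + 2 * lorIP x y + lorIP y y := by
  have := lorIP_comm x y
  simp only [← lorForm_apply, map_add, LinearMap.add_apply] at *
  linarith

theorem lorIP_sub_self {n : ℕ} (x y : Fin (n + 1) → ℝ) :
    lorIP (x - y) (x - y) = lorIP x x - 2 * lorIP x y + lorIP y y := by
  have := lorIP_comm x y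
  simp only [← lorForm_apply, map_sub, LinearMap.sub_apply] at *
  linarith

theorem lorIP_smul_right {n : ℕ} (c : ℝ) (x y : Fin (n + 1) → ℝ) :
    lorIP x (c • y) = c * lorIP x y := by
  simp only [← lorForm_apply, map_smul, smul_eq_mul]

theorem lorIP_smul_left {n : ℕ} (c : ℝ) (x y : Fin (n + 1) → ℝ) :
    lorIP (c • x) y = c * lorIP x y := by
  rw [lorIP_comm, lorIP_smul_right, lorIP_comm]

theorem lorIP_add_left {n : ℕ} (x y z : Fin (n + 1) → ℝ) :
    lorIP (x + y) z = lorIP x z + lorIP y z := by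
  simp only [← lorForm_apply, map_add, LinearMap.add_apply]

theorem contDiff_lorIP {n : ℕ} {E : Type*} [NormedAddCommGroup E] [NormedSpace ℝ E]
    {f g : E → Fin (n + 1) → ℝ} (hf : ContDiff ℝ (⊤ : ℕ∞) f) (hg : ContDiff ℝ (⊤ : ℕ∞) g) :
    ContDiff ℝ (⊤ : ℕ∞) fun x => lorIP (f x) (g x) := by
  have hf' := contDiff_pi.1 hf
  have hg' := contDiff_pi.1 hg
  unfold lorIP
  exact (ContDiff.sum fun i _ => (hf' i).mul (hg' i)).sub
    (contDiff_const.mul ((hf' 0).mul (hg' 0)))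

/-- The Lorentzian inner product is nondegenerate. -/
theorem eq_zero_of_forall_lorIP_eq_zero {n : ℕ} {y : Fin (n + 1) → ℝ}
    (h : ∀ x, lorIP y x = 0) : y = 0 := by
  ext i
  have := h (Pi.single i 1)
  by_cases hi : i = 0
  · subst hi
    simp [lorIP, Pi.single_apply] at this
    simp; linarith
  · simpa [lorIP, Pi.single_apply, Ne.symm hi] using this

/-- A nonzero vector orthogonal to a time-like vector has positive square. -/
theorem lorIP_self_pos_of_orthogonal {n : ℕ} {e v : Fin (n + 1) → ℝ}
    (hv : lorIP v v < 0) (he : e ≠ 0) (hev : lorIP e v = 0) : 0 < lorIP e e := by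
  have cs := Finset.sum_mul_sq_le_sq_mul_sq Finset.univ
    (fun i : Fin n => e i.succ) (fun i : Fin n => v i.succ)
  simp only [lorIP, Fin.sum_univ_succ, ← pow_two] at *
  set a := ∑ i : Fin n, e i.succ ^ 2 with ha
  set b := ∑ i : Fin n, v i.succ ^ 2
  have ha0 : 0 ≤ a := Finset.sum_nonneg fun i _ => sq_nonneg _
  have hb0 : 0 ≤ b := Finset.sum_nonneg fun i _ => sq_nonneg _
  have hs : ∑ i : Fin n, e i.succ * v i.succ = e 0 * v 0 := by linarith
  rw [hs] at cs
  have hv0 : 0 < v 0 ^ 2 := by linarith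
  rcases ha0.eq_or_lt with h0 | hpos
  · exfalso
    apply he
    have hz := (Finset.sum_eq_zero_iff_of_nonneg (fun i _ => sq_nonneg _)).1 (ha ▸ h0.symm)
    have he0 : e 0 = 0 := by
      by_contra hne
      have : 0 < e 0 ^ 2 := by positivity
      have := mul_pos this hv0
      rw [← h0] at cs
      nlinarith
    ext i
    refine Fin.cases he0 (fun j => ?_) i
    simpa using hz j (Finset.mem_univ j)
  · have : e 0 ^ 2 * v 0 ^ 2 < a * v 0 ^ 2 := by nlinarith
    have := lt_of_mul_lt_mul_right this hv0.le
    linarith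

/-- If the form is nonnegative on a subspace, its null vectors there are orthogonal to it. -/
theorem lorIP_eq_zero_of_null {n : ℕ} {V : Submodule ℝ (Fin (n + 1) → ℝ)}
    (hV : ¬ LTimeLike V) {v w : Fin (n + 1) → ℝ} (hv : v ∈ V) (hw : w ∈ V)
    (hww : lorIP w w = 0) : lorIP v w = 0 := by
  by_contra hne
  apply hV
  refine ⟨v + (-(lorIP v v + 1) / (2 * lorIP v w)) • w,
    V.add_mem hv (V.smul_mem _ hw), ?_⟩
  rw [lorIP_add_self, lorIP_smul_right, lorIP_smul_right, lorIP_smul_left, hww]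
  have : 2 * (-(lorIP v v + 1) / (2 * lorIP v w) * lorIP v w) = -(lorIP v v + 1) := by
    field_simp
  linarith

/-- A subspace which is time-like or space-like, of codimension one and orthogonal to `e ≠ 0`,
does not contain `e`, and `e` is not null. -/
theorem normal_not_null {n : ℕ} {V : Submodule ℝ (Fin (n + 1) → ℝ)}
    (hV : LTimeLike V ∨ LSpaceLike V) (hdim : Module.finrank ℝ V = n)
    {e : Fin (n + 1) → ℝ} (he : e ≠ 0) (hperp : ∀ v ∈ V, lorIP e v = 0) :
    lorIP e e ≠ 0 ∧ V ⊔ Submodule.span ℝ {e} = ⊤ := by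
  have hmem : e ∉ V := by
    intro hmem
    have h0 := hperp e hmem
    rcases hV with ⟨v, hv, hneg⟩ | hs
    · exact (lorIP_self_pos_of_orthogonal hneg he (hperp v hv)).ne' h0
    · exact (hs e hmem he).ne' h0
  have htop : V ⊔ Submodule.span ℝ {e} = ⊤ := by
    have hlt : V < V ⊔ Submodule.span ℝ {e} := by
      refine lt_of_le_of_ne le_sup_left fun heq => hmem ?_
      rw [heq]
      exact Submodule.mem_sup_right (Submodule.mem_span_singleton_self e)
    have h1 := Submodule.finrank_lt_finrank_of_lt hlt
    have h2 := Submodule.finrank_le (V ⊔ Submodule.span ℝ {e})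
    apply Submodule.eq_top_of_finrank_eq
    simp only [Module.finrank_fin_fun] at *
    omega
  refine ⟨?_, htop⟩
  rcases hV with ⟨v, hv, hneg⟩ | hs
  · exact (lorIP_self_pos_of_orthogonal hneg he (hperp v hv)).ne'
  · intro h0
    have hx : (Pi.single 0 1 : Fin (n + 1) → ℝ) ∈ V ⊔ Submodule.span ℝ {e} := by
      rw [htop]; trivial
    obtain ⟨v, hv, z, hz, hvz⟩ := Submodule.mem_sup.1 hx
    obtain ⟨c, rfl⟩ := Submodule.mem_span_singleton.1 hz
    have hneg : lorIP (v + c • e) (v + c • e) = -1 := by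
      rw [hvz]
      simp [lorIP, Pi.single_apply]
      norm_num
    rw [lorIP_add_self, lorIP_smul_right, lorIP_smul_right, lorIP_smul_left, h0,
      lorIP_comm v e, hperp v hv] at hneg
    by_cases hv0 : v = 0
    · simp [hv0, lorIP] at hneg
    · have := hs v hv hv0
      linarith

/-- The model map `τ ∘ Φₙ`, sending `x` to `(x₁, …, xₙ, x₀², 0, …, 0)`. -/
def foldModel (k n : ℕ) (x : Fin (n + 1) → ℝ) (i : Fin (k + 1)) : ℝ :=
  if h : (i : ℕ) < n then x ⟨(i : ℕ) + 1, by omega⟩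
  else if (i : ℕ) = n then x 0 ^ 2
  else 0

theorem coords_eq_of_foldModel_eq {k n : ℕ} (hnk : n < k) {x y : Fin (n + 1) → ℝ}
    (h : foldModel k n x = foldModel k n y) :
    (∀ j : Fin n, x j.succ = y j.succ) ∧ (x 0 = y 0 ∨ x 0 = - y 0) := by
  constructor
  · intro j
    have := congrFun h ⟨j, by omega⟩
    simpa [foldModel, Fin.succ] using this
  · have := congrFun h ⟨n, by omega⟩
    simpa [foldModel, sq_eq_sq_iff_eq_or_eq_neg] using this

/-- A map `𝒜`-equivalent to the model cannot be constant on three distinct points. -/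
theorem not_aequiv_foldModel {k n : ℕ} (hnk : n < k)
    {f : (Fin (n + 1) → ℝ) → (Fin (k + 1) → ℝ)} {a b c : Fin (n + 1) → ℝ}
    (hab : a ≠ b) (hac : a ≠ c) (hbc : b ≠ c) (fab : f a = f b) (fac : f a = f c) :
    ¬ AEquiv f (foldModel k n) := by
  rintro ⟨h, H, -, -, -, -, hg⟩
  have key : ∀ z, foldModel k n (h.symm z) = H (f z) := fun z => by simp [hg]
  obtain ⟨ab, ab0⟩ := coords_eq_of_foldModel_eq hnk ((key a).trans (fab ▸ (key b).symm))
  obtain ⟨ac, ac0⟩ := coords_eq_of_foldModel_eq hnk ((key a).trans (fac ▸ (key c).symm))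
  have inj : ∀ {x y}, (∀ j : Fin n, h.symm x j.succ = h.symm y j.succ) →
      h.symm x 0 = h.symm y 0 → x = y := fun hs h0 =>
    h.symm.injective (funext fun i => Fin.cases h0 hs i)
  rcases ab0 with ab0 | ab0
  · exact hab (inj ab ab0)
  · rcases ac0 with ac0 | ac0
    · exact hac (inj ac ac0)
    · exact hbc (inj (fun j => (ab j).symm.trans (ac j)) (by linarith))

theorem sub_mem_recSub {n k : ℕ} (p : Fin (k + 1) → Fin (n + 1) → ℝ) (i : Fin (k + 1)) :
    p i - p 0 ∈ recSub p :=
  Submodule.subset_span ⟨i, rfl⟩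

/-- If the recognition subspace is light-like, the mapping is not equivalent to the model. -/
theorem not_aequiv_of_lightLike {k n : ℕ} (hnk : n < k) (p : Fin (k + 1) → Fin (n + 1) → ℝ)
    (hl : LLightLike (recSub p)) : ¬ AEquiv (LorDSM p) (foldModel k n) := by
  obtain ⟨ht, hs⟩ := hl
  simp only [LSpaceLike, not_forall, not_lt] at hs
  obtain ⟨w, hw, hw0, hww⟩ := hs
  have hww : lorIP w w = 0 :=
    le_antisymm hww (not_lt.1 fun hlt => ht ⟨w, hw, hlt⟩)
  have hval : ∀ t : ℝ, LorDSM p (p 0 + t • w) = LorDSM p (p 0) := by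
    intro t
    funext i
    have hi := lorIP_eq_zero_of_null ht (sub_mem_recSub p i) hw hww
    have e1 : p 0 + t • w - p i = t • w - (p i - p 0) := by abel
    have e2 : p 0 - p i = (0 : ℝ) • w - (p i - p 0) := by simp
    simp only [LorDSM]
    rw [e1, e2]
    simp only [lorIP_sub_self, lorIP_smul_left, lorIP_smul_right, lorIP_comm w, hww, hi]
    simp
  refine not_aequiv_foldModel hnk (a := p 0) (b := p 0 + (1 : ℝ) • w) (c := p 0 + (2 : ℝ) • w)
    ?_ ?_ ?_ (hval 1).symm (hval 2).symm
  · simpa using hw0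
  · simpa using hw0
  · intro h
    have h' := smul_left_injective ℝ hw0 (add_left_cancel h)
    norm_num at h'

theorem recSubUpTo_eq_span {k n : ℕ} (hnk : n < k) (p : Fin (k + 1) → Fin (n + 1) → ℝ) :
    recSubUpTo p n = Submodule.span ℝ
      (Set.range fun j : Fin n => p ⟨(j : ℕ) + 1, by omega⟩ - p 0) := by
  apply le_antisymm
  · refine Submodule.span_le.2 ?_
    rintro v ⟨i, hi, rfl⟩
    by_cases h0 : i = 0
    · simp [h0]
    · have hpos : (i : ℕ) ≠ 0 := fun h => h0 (Fin.ext h)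
      refine Submodule.subset_span ⟨⟨i - 1, by omega⟩, ?_⟩
      have : (⟨(i : ℕ) - 1 + 1, by omega⟩ : Fin (k + 1)) = i := Fin.ext (by simp; omega)
      simp [this]
  · refine Submodule.span_mono ?_
    rintro _ ⟨j, rfl⟩
    exact ⟨_, by simp, rfl⟩

theorem recSub_eq_span {k n : ℕ} (hnk : n < k) (p : Fin (k + 1) → Fin (n + 1) → ℝ)
    (h1 : Module.finrank ℝ (recSubUpTo p n) = n) (h2 : Module.finrank ℝ (recSub p) = n) :
    recSub p = Submodule.span ℝ
      (Set.range fun j : Fin n => p ⟨(j : ℕ) + 1, by omega⟩ - p 0) := by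
  rw [← recSubUpTo_eq_span hnk]
  refine (Submodule.eq_of_le_of_finrank_eq (Submodule.span_mono ?_) (h1.trans h2.symm)).symm
  rintro _ ⟨i, -, rfl⟩
  exact ⟨i, rfl⟩

/-- If `e` is orthogonal to the vectors `u j`, then it is orthogonal to their span. -/
theorem lorIP_eq_zero_of_mem_span {n : ℕ} {ι : Type*} {u : ι → Fin (n + 1) → ℝ}
    {e v : Fin (n + 1) → ℝ} (he : ∀ j, lorIP e (u j) = 0)
    (hv : v ∈ Submodule.span ℝ (Set.range u)) : lorIP e v = 0 := by
  have : Submodule.span ℝ (Set.range u) ≤ LinearMap.ker (lorForm n e) := by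
    refine Submodule.span_le.2 ?_
    rintro _ ⟨j, rfl⟩
    exact he j
  exact this hv

/-- `n` vectors of `ℝ^{1,n}` have a common nonzero normal vector. -/
theorem exists_normal {n : ℕ} (u : Fin n → Fin (n + 1) → ℝ) :
    ∃ e, e ≠ 0 ∧ ∀ j, lorIP e (u j) = 0 := by
  let F : (Fin (n + 1) → ℝ) →ₗ[ℝ] (Fin n → ℝ) := LinearMap.pi fun j => (lorForm n).flip (u j)
  have hF : LinearMap.ker F ≠ ⊥ := LinearMap.ker_ne_bot_of_finrank_lt (by simp)
  obtain ⟨e, he, he0⟩ := Submodule.exists_mem_ne_zero_of_ne_bot hF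
  exact ⟨e, he0, fun j => congrFun (LinearMap.mem_ker.1 he) j⟩

/-- Linear coordinates `y ↦ (⟨y,e⟩, ⟨y,u₁⟩, …, ⟨y,uₙ⟩)`, when `e` and the `u j` span. -/
theorem exists_coordinates {n : ℕ} (u : Fin n → Fin (n + 1) → ℝ) (e : Fin (n + 1) → ℝ)
    (htop : Submodule.span ℝ (Set.range u) ⊔ Submodule.span ℝ {e} = ⊤) :
    ∃ T : (Fin (n + 1) → ℝ) ≃ₗ[ℝ] (Fin (n + 1) → ℝ),
      (∀ y, T y 0 = lorIP y e) ∧ ∀ y j, T y (Fin.succ j) = lorIP y (u j) := by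
  let F : (Fin (n + 1) → ℝ) →ₗ[ℝ] (Fin (n + 1) → ℝ) :=
    LinearMap.pi fun i => (lorForm n).flip (Fin.cons (α := fun _ => Fin (n + 1) → ℝ) e u i)
  have hF : Function.Injective F := by
    rw [← LinearMap.ker_eq_bot, LinearMap.ker_eq_bot']
    intro y hy
    apply eq_zero_of_forall_lorIP_eq_zero
    intro x
    have hx : x ∈ Submodule.span ℝ (Set.range u) ⊔ Submodule.span ℝ {e} := by
      rw [htop]; trivial
    obtain ⟨v, hv, z, hz, rfl⟩ := Submodule.mem_sup.1 hx
    obtain ⟨c, rfl⟩ := Submodule.mem_span_singleton.1 hz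
    have hy0 : lorIP y e = 0 := congrFun hy 0
    rw [lorIP_comm, lorIP_add_left, lorIP_comm v, lorIP_smul_left, lorIP_comm e, hy0,
      lorIP_eq_zero_of_mem_span (fun j => congrFun hy (Fin.succ j)) hv]
    simp
  exact ⟨LinearEquiv.ofInjectiveEndo F hF, fun y => rfl, fun y j => rfl⟩

/-- The mapping is equivalent to the model when the recognition subspace has a non-null
normal vector. -/
theorem aequiv_foldModel {k n : ℕ} (hnk : n < k) (p : Fin (k + 1) → Fin (n + 1) → ℝ)
    (hspan : recSub p = Submodule.span ℝ
      (Set.range fun j : Fin n => p ⟨(j : ℕ) + 1, by omega⟩ - p 0))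
    (e : Fin (n + 1) → ℝ) (hperp : ∀ v ∈ recSub p, lorIP e v = 0) (hee : lorIP e e ≠ 0)
    (htop : recSub p ⊔ Submodule.span ℝ {e} = ⊤) :
    AEquiv (LorDSM p) (foldModel k n) := by
  obtain ⟨T, hT0, hTs⟩ := exists_coordinates _ e (hspan ▸ htop)
  set q : Fin (k + 1) → Fin (n + 1) → ℝ := fun i => p i - p 0 with hq
  have hTs' : ∀ x (j : Fin n),
      lorIP (T.symm x) (q ⟨(j : ℕ) + 1, by omega⟩) = x j.succ := fun x j => by
    rw [← hTs, T.apply_symm_apply]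
  have hq0 : q 0 = 0 := by simp [hq]
  have hqe : ∀ i, lorIP e (q i) = 0 := fun i => hperp _ (sub_mem_recSub p i)
  -- the foot on `recSub p` with prescribed products with the spanning vectors
  let B : (Fin n → ℝ) → Fin (n + 1) → ℝ :=
    fun u => T.symm (Fin.cons (α := fun _ => ℝ) 0 u)
  have hBs : ∀ u (j : Fin n), lorIP (B u) (q ⟨(j : ℕ) + 1, by omega⟩) = u j :=
    fun u j => by simp [B, hTs']
  have hBe : ∀ u, lorIP (B u) e = 0 := fun u => by
    rw [← hT0]; simp [B]
  have hBc : ContDiff ℝ (⊤ : ℕ∞) B := by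
    refine (LinearMap.toContinuousLinearMap T.symm.toLinearMap).contDiff.comp ?_
    refine contDiff_pi.2 fun i => Fin.cases ?_ (fun j => ?_) i
    · simpa using contDiff_const
    · simpa using contDiff_apply ℝ ℝ j
  have hdecomp : ∀ x, T.symm x = B (fun j => x j.succ) + (x 0 / lorIP e e) • e := by
    intro x
    apply T.injective
    ext i
    refine Fin.cases ?_ (fun j => ?_) i
    · rw [hT0, hT0, lorIP_add_left, hBe, lorIP_smul_left, ← hT0, T.apply_symm_apply]
      field_simp
      simp
    · rw [hTs, hTs, lorIP_add_left, lorIP_smul_left]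
      have := hqe ⟨(j : ℕ) + 1, by omega⟩
      have h2 := hBs (fun j => x j.succ) j
      have h3 := hTs' x j
      simp only [hq] at this h2 h3
      rw [this, h2, h3]; ring
  -- products with the spanning vectors, read off from the target
  let U : (Fin (k + 1) → ℝ) → Fin n → ℝ := fun Z j =>
    (Z 0 - Z ⟨(j : ℕ) + 1, by omega⟩ +
      lorIP (q ⟨(j : ℕ) + 1, by omega⟩) (q ⟨(j : ℕ) + 1, by omega⟩)) / 2
  let R : (Fin (k + 1) → ℝ) → Fin n → ℝ := fun W j => W ⟨j, by omega⟩
  have hUc : ContDiff ℝ (⊤ : ℕ∞) U := contDiff_pi.2 fun j => by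
    simp only [U]; fun_prop
  have hRc : ContDiff ℝ (⊤ : ℕ∞) R := contDiff_pi.2 fun j => by
    simp only [R]; fun_prop
  let Hf : (Fin (k + 1) → ℝ) → (Fin (k + 1) → ℝ) := fun Z i =>
    if h : (i : ℕ) < n then U Z ⟨i, h⟩
    else if (i : ℕ) = n then lorIP e e * (Z 0 - lorIP (B (U Z)) (B (U Z)))
    else (lorIP (B (U Z) - q i) (B (U Z) - q i) + Z 0 - lorIP (B (U Z)) (B (U Z)) - Z i) / 2
  let Hg : (Fin (k + 1) → ℝ) → (Fin (k + 1) → ℝ) := fun W i =>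
    W ⟨n, by omega⟩ / lorIP e e + lorIP (B (R W) - q i) (B (R W) - q i)
      - (if (i : ℕ) ≤ n then 0 else 2 * W i)
  have hRH : ∀ Z, R (Hf Z) = U Z := fun Z => by
    funext j; simp [R, Hf]
  have hHg0 : ∀ W, Hg W 0 = W ⟨n, by omega⟩ / lorIP e e + lorIP (B (R W)) (B (R W)) :=
    fun W => by simp [Hg, hq0]
  have hUH : ∀ W, U (Hg W) = R W := fun W => by
    funext j
    have hb := hBs (R W) j
    simp only [U]
    rw [hHg0]
    simp only [Hg, lorIP_sub_self, hb]
    rw [if_pos (by simp)]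
    ring
  have hleft : Function.LeftInverse Hg Hf := by
    intro Z
    funext i
    simp only [Hg, hRH]
    have hn' : Hf Z ⟨n, by omega⟩ = lorIP e e * (Z 0 - lorIP (B (U Z)) (B (U Z))) := by
      simp [Hf]
    rw [hn', mul_div_cancel_left₀ _ hee]
    by_cases hi : (i : ℕ) ≤ n
    · rw [if_pos hi]
      by_cases h0 : i = 0
      · subst h0; simp [hq0]
      · have hpos : (i : ℕ) ≠ 0 := fun h => h0 (Fin.ext h)
        have hi' : (⟨(i : ℕ) - 1 + 1, by omega⟩ : Fin (k + 1)) = i :=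
          Fin.ext (by simp; omega)
        have hb := hBs (U Z) ⟨i - 1, by omega⟩
        simp only [U, hi'] at hb
        rw [lorIP_sub_self, hb]
        ring
    · rw [if_neg hi]
      simp only [Hf]
      rw [dif_neg (by omega), if_neg (by omega)]
      ring
  have hright : Function.RightInverse Hg Hf := by
    intro W
    funext i
    simp only [Hf, hUH, hHg0]
    split_ifs with h h'
    · simp [R]
    · have : (⟨n, by omega⟩ : Fin (k + 1)) = i := Fin.ext h'.symm
      rw [this]; field_simp; ring
    · simp only [Hg]
      rw [if_neg (by omega)]
      ring
  refine ⟨⟨fun x => T.symm x + p 0, fun y => T (y - p 0), fun x => by simp, fun y => by simp⟩,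
    ⟨Hf, Hg, hleft, hright⟩, ?_, ?_, ?_, ?_, ?_⟩
  · exact (LinearMap.toContinuousLinearMap T.symm.toLinearMap).contDiff.add contDiff_const
  · exact (LinearMap.toContinuousLinearMap T.toLinearMap).contDiff.comp
      (contDiff_id.sub contDiff_const)
  · have hBU := hBc.comp hUc
    have hBB := contDiff_lorIP hBU hBU
    refine contDiff_pi.2 fun i => ?_
    change ContDiff ℝ _ fun Z => Hf Z i
    have hBq := contDiff_lorIP (hBU.sub (contDiff_const (c := q i)))
      (hBU.sub (contDiff_const (c := q i)))
    simp only [Hf]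
    split_ifs with h h'
    · exact contDiff_pi.1 hUc _
    · exact contDiff_const.mul ((contDiff_apply ℝ ℝ _).sub hBB)
    · exact (((hBq.add (contDiff_apply ℝ ℝ _)).sub hBB).sub (contDiff_apply ℝ ℝ _)).div_const _
  · have hBR := hBc.comp hRc
    refine contDiff_pi.2 fun i => ?_
    change ContDiff ℝ _ fun W => Hg W i
    have hBq := contDiff_lorIP (hBR.sub (contDiff_const (c := q i)))
      (hBR.sub (contDiff_const (c := q i)))
    simp only [Hg]
    refine (((contDiff_apply ℝ ℝ _).div_const _).add hBq).sub ?_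
    split_ifs
    · exact contDiff_const
    · exact contDiff_const.mul (contDiff_apply ℝ ℝ _)
  · funext x
    suffices h : LorDSM p (T.symm x + p 0) = Hg (foldModel k n x) by
      change _ = Hf (LorDSM p (T.symm x + p 0))
      rw [h, hright]
    have hR : R (foldModel k n x) = fun j => x j.succ := by
      funext j; simp [R, foldModel, Fin.succ]
    funext i
    have hlast : (if (i : ℕ) ≤ n then 0 else 2 * foldModel k n x i) = 0 := by
      split_ifs with h
      · rfl
      · simp only [foldModel]
        rw [dif_neg (by omega), if_neg (by omega), mul_zero]
    have e1 : T.symm x + p 0 - p i = T.symm x - q i := by simp only [hq]; abel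
    simp only [LorDSM, Hg, hR, hlast]
    rw [e1, hdecomp]
    rw [lorIP_sub_self _ (q i), lorIP_add_self, lorIP_sub_self _ (q i)]
    simp only [lorIP_add_left, lorIP_smul_left, lorIP_smul_right, hBe, hqe, foldModel]
    rw [dif_neg (by simp), if_pos trivial]
    field_simp
    ring

theorem theorem4_2a (k n : ℕ) (hn : 1 ≤ n) (hnk : n < k)
    (p : Fin (k + 1) → Fin (n + 1) → ℝ)
    (h1 : Module.finrank ℝ (recSubUpTo p n) = n)
    (h2 : Module.finrank ℝ (recSub p) = n) :
    AEquiv (LorDSM p)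
        (fun (x : Fin (n + 1) → ℝ) (i : Fin (k + 1)) =>
          if h : (i : ℕ) < n then x ⟨(i : ℕ) + 1, by omega⟩
          else if (i : ℕ) = n then x 0 ^ 2
          else 0)
      ↔ (LTimeLike (recSub p) ∨ LSpaceLike (recSub p)) := by
  change AEquiv (LorDSM p) (foldModel k n) ↔ _
  refine ⟨fun h => ?_, fun hV => ?_⟩
  · by_contra hne
    rw [not_or] at hne
    exact not_aequiv_of_lightLike hnk p hne h
  · have hspan := recSub_eq_span hnk p h1 h2
    obtain ⟨e, he, hperp⟩ :=
      exists_normal fun j : Fin n => p ⟨(j : ℕ) + 1, by omega⟩ - p 0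
    have hperp' : ∀ v ∈ recSub p, lorIP e v = 0 := fun v hv =>
      lorIP_eq_zero_of_mem_span hperp (hspan ▸ hv)
    obtain ⟨hee, htop⟩ := normal_not_null hV h2 he hperp'
    exact aequiv_foldModel hnk p hspan e hperp' hee htop
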